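/- Let S be an S-tree. Then the independence number of S equals |Supp(S)|, and Supp(S) is the unique maximum independent set of S; that is, every independent set of S of cardinality |Supp(S)| equals Supp(S). -/

import Mathlib

open scoped Classical

namespace NullDecomp

variable {V : Type*}

/-- The null space of the real adjacency matrix of a graph. -/
def nullSpace [Fintype V] (G : SimpleGraph V) : Set (V → ℝ) :=
  {x | Matrix.mulVec (G.adjMatrix ℝ) x = 0}

/-- The support of the null space: vertices with a nonzero entry in some null vector. -/
def supportSet [Fintype V] (G : SimpleGraph V) : Set V :=
  {v | ∃ x ∈ nullSpace G, x v ≠ 0}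

/-- The (open) neighborhood of a set of vertices. -/
def nbhdSet (G : SimpleGraph V) (A : Set V) : Set V :=
  {v | ∃ u ∈ A, G.Adj u v}

/-- The closed neighborhood of a set of vertices. -/
def closedNbhd (G : SimpleGraph V) (A : Set V) : Set V :=
  A ∪ nbhdSet G A

/-- The core of a graph: the neighborhood of the support of the null space. -/
def coreSet [Fintype V] (G : SimpleGraph V) : Set V :=
  nbhdSet G (supportSet G)

/-- A tree is an S-tree if the closed neighborhood of its support is everything. -/
def IsSTree [Fintype V] (G : SimpleGraph V) : Prop :=
  G.IsTree ∧ closedNbhd G (supportSet G) = Set.univ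

/-- A matching: a set of edges of `G`, pairwise disjoint. -/
def IsMatchingSet (G : SimpleGraph V) (M : Finset (Sym2 V)) : Prop :=
  (↑M : Set (Sym2 V)) ⊆ G.edgeSet ∧
    ∀ e ∈ M, ∀ f ∈ M, e ≠ f → ∀ v : V, v ∈ e → v ∉ f

/-- A maximum matching. -/
def IsMaxMatching [Fintype V] (G : SimpleGraph V) (M : Finset (Sym2 V)) : Prop :=
  IsMatchingSet G M ∧ ∀ M' : Finset (Sym2 V), IsMatchingSet G M' → M'.card ≤ M.card

/-- The matching number. -/
noncomputable def matchingNumber [Fintype V] (G : SimpleGraph V) : ℕ :=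
  sSup {n | ∃ M : Finset (Sym2 V), IsMatchingSet G M ∧ M.card = n}

/-- An independent set of vertices. -/
def IsIndep (G : SimpleGraph V) (A : Set V) : Prop :=
  ∀ u ∈ A, ∀ w ∈ A, ¬ G.Adj u w

/-- The independence number. -/
noncomputable def indepNumber [Fintype V] (G : SimpleGraph V) : ℕ :=
  sSup {n | ∃ A : Set V, IsIndep G A ∧ A.ncard = n}

/-- A vertex cover. -/
def IsVertexCover (G : SimpleGraph V) (Cs : Set V) : Prop :=
  ∀ e ∈ G.edgeSet, ∃ v ∈ Cs, v ∈ e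

/-- The vertex cover number. -/
noncomputable def coverNumber [Fintype V] (G : SimpleGraph V) : ℕ :=
  sInf {n | ∃ Cs : Set V, IsVertexCover G Cs ∧ Cs.ncard = n}

/-- The nullity of a graph: dimension of the kernel of its adjacency matrix. -/
noncomputable def nullity [Fintype V] (G : SimpleGraph V) : ℕ :=
  Module.finrank ℝ (LinearMap.ker (Matrix.mulVecLin (G.adjMatrix ℝ)))

/-- The number of maximum matchings of a graph. -/
noncomputable def numMaxMatchings [Fintype V] (G : SimpleGraph V) : ℕ :=
  Set.ncard {M : Finset (Sym2 V) | IsMaxMatching G M}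

/-- `C` is (the vertex set of) a connected component of the subgraph of `T`
induced by the closed neighborhood of the support of `T`. -/
def IsSComponent [Fintype V] (T : SimpleGraph V) (C : Set V) : Prop :=
  ∃ c : (T.induce (closedNbhd T (supportSet T))).ConnectedComponent,
    C = Subtype.val '' c.supp

/-- `C` is (the vertex set of) a connected component of the subgraph of `T`
induced by the complement of the closed neighborhood of the support of `T`. -/
def IsNComponent [Fintype V] (T : SimpleGraph V) (C : Set V) : Prop :=
  ∃ c : (T.induce ((closedNbhd T (supportSet T))ᶜ)).ConnectedComponent,
    C = Subtype.val '' c.supp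

/-- The zero-extension to `ℝ^V` of the null space of the subgraph of `T` induced by `C`:
vectors vanishing outside `C` whose restriction to `C` is a null vector of `T.induce C`. -/
noncomputable def extNull [Fintype V] (T : SimpleGraph V) (C : Set V) : Submodule ℝ (V → ℝ) :=
  LinearMap.ker ((Matrix.mulVecLin ((T.induce C).adjMatrix ℝ)).comp
      (LinearMap.funLeft ℝ ℝ (Subtype.val : ↥C → V))) ⊓
  LinearMap.ker (LinearMap.funLeft ℝ ℝ (Subtype.val : ↥(Cᶜ) → V))

/-- An acyclic graph on a nonempty finite vertex set has fewer edges than vertices. -/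
lemma card_edgeSet_lt_of_isAcyclic {W : Type*} [Finite W] [Nonempty W] {G : SimpleGraph W}
    (hG : G.IsAcyclic) : Nat.card G.edgeSet < Nat.card W := by
  have := Fintype.ofFinite W
  obtain ⟨T, hGT, -, hT⟩ :=
    (SimpleGraph.connected_top (V := W)).exists_isTree_le_of_le_of_isAcyclic le_top hG
  have hcard := (SimpleGraph.isTree_iff_connected_and_card.mp hT).2
  have hle : Nat.card G.edgeSet ≤ Nat.card T.edgeSet :=
    Nat.card_mono (Set.toFinite _) (SimpleGraph.edgeSet_mono hGT)
  omega

lemma mem_nullSpace_iff [Fintype V] {G : SimpleGraph V} {x : V → ℝ} :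
    x ∈ nullSpace G ↔ ∀ v, ∑ w, (if G.Adj v w then x w else 0) = 0 := by
  simp [nullSpace, funext_iff, Matrix.mulVec, dotProduct, SimpleGraph.adjMatrix_apply]

/-- No null vector of a tree is nonzero at both ends of an edge. -/
lemma nullSpace_mul_eq_zero_of_adj [Fintype V] {G : SimpleGraph V} (hG : G.IsAcyclic)
    {x : V → ℝ} (hx : x ∈ nullSpace G) {u w : V} (huw : G.Adj u w) : x u * x w = 0 := by
  rw [mem_nullSpace_iff] at hx
  obtain ⟨c⟩ := hG.colorable_two
  set H := G.deleteEdges {s(u, w)} with hH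
  have hw : ¬ H.Reachable u w :=
    SimpleGraph.isBridge_iff.mp (SimpleGraph.isAcyclic_iff_forall_adj_isBridge.mp hG huw)
  have hstep : ∀ {a b}, G.Adj a b → s(a, b) ≠ s(u, w) → H.Reachable u a → H.Reachable u b :=
    fun hab hne ha ↦ ha.trans (SimpleGraph.Adj.reachable (by
      rw [hH, SimpleGraph.deleteEdges_adj]; exact ⟨hab, hne⟩))
  have hcol : ∀ {a b}, G.Adj a b → c a ≠ c b := fun h ↦ c.valid h
  let P : V → Prop := fun v ↦ H.Reachable u v ∧ c v ≠ c u
  let Q : V → Prop := fun v ↦ H.Reachable u v ∧ c v = c u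
  have hfin : ∀ i j k : Fin 2, i ≠ j → k ≠ j → i = k := by decide
  -- each edge from the side of `u` joins the two colour classes, except the edge `uw` itself
  have hPQ : ∀ {a b}, P a → G.Adj a b → Q b := by
    intro a b ha hab
    refine ⟨hstep hab ?_ ha.1, hfin _ _ _ (hcol hab).symm ha.2.symm⟩
    intro h
    rcases Sym2.eq_iff.mp h with ⟨rfl, -⟩ | ⟨rfl, -⟩
    · exact ha.2 rfl
    · exact hw ha.1
  have hQP : ∀ {a b}, Q a → G.Adj a b → (a = u → b ≠ w) → P b := by
    intro a b ha hab h1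
    refine ⟨hstep hab ?_ ha.1, fun h ↦ hcol hab (ha.2.trans h.symm)⟩
    intro h
    rcases Sym2.eq_iff.mp h with ⟨h2, h3⟩ | ⟨rfl, -⟩
    · exact h1 h2 h3
    · exact hw ha.1
  have hQu : Q u := ⟨.refl _, rfl⟩
  have hPw : ¬ P w := fun h ↦ hw h.1
  have e1 : ∀ a, P a →
      ∑ b, (if G.Adj a b then (if Q b then x b else 0) else 0) = 0 := by
    intro a ha
    refine (Finset.sum_congr rfl fun b _ ↦ ?_).trans (hx a)
    by_cases hab : G.Adj a b
    · simp [hab, hPQ ha hab]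
    · simp [hab]
  have e2 : ∀ b, Q b → b ≠ u →
      ∑ a, (if G.Adj b a then (if P a then x a else 0) else 0) = 0 := by
    intro b hb hbu
    refine (Finset.sum_congr rfl fun a _ ↦ ?_).trans (hx b)
    by_cases hab : G.Adj b a
    · simp [hab, hQP hb hab (fun h ↦ absurd h hbu)]
    · simp [hab]
  have e3 : ∑ a, (if G.Adj u a then (if P a then x a else 0) else 0) = - x w := by
    rw [eq_neg_iff_add_eq_zero, ← Fintype.sum_ite_eq w x, ← Finset.sum_add_distrib]
    refine (Finset.sum_congr rfl fun a _ ↦ ?_).trans (hx u)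
    by_cases haw : w = a
    · subst haw; simp [hPw, huw]
    · by_cases hua : G.Adj u a
      · simp [haw, hua, hQP hQu hua (fun _ h ↦ haw h.symm)]
      · simp [haw, hua]
  have key : ∑ a, (if P a then x a else 0) *
        ∑ b, (if G.Adj a b then (if Q b then x b else 0) else 0) =
      ∑ b, (if Q b then x b else 0) *
        ∑ a, (if G.Adj b a then (if P a then x a else 0) else 0) := by
    simp_rw [Finset.mul_sum]
    rw [Finset.sum_comm]
    refine Finset.sum_congr rfl fun b _ ↦ Finset.sum_congr rfl fun a _ ↦ ?_
    rw [G.adj_comm a b]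
    split_ifs <;> ring
  rw [Finset.sum_eq_zero, Finset.sum_eq_single u] at key
  · rw [e3, if_pos hQu] at key
    linarith
  · intro b _ hbu
    by_cases hb : Q b
    · rw [e2 b hb hbu, mul_zero]
    · simp [hb]
  · simp
  · intro a _
    by_cases ha : P a
    · rw [e1 a ha, mul_zero]
    · simp [ha]

/-- The support of a forest is an independent set. -/
lemma isIndep_supportSet [Fintype V] {G : SimpleGraph V} (hG : G.IsAcyclic) :
    IsIndep G (supportSet G) := by
  rintro u ⟨x, hx, hxu⟩ w ⟨y, hy, hyw⟩ huw
  have hxy : x + y ∈ nullSpace G := by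
    simp only [nullSpace, Set.mem_ofPred_eq] at hx hy ⊢
    rw [Matrix.mulVec_add, hx, hy, add_zero]
  have h1 := nullSpace_mul_eq_zero_of_adj hG hx huw
  have h2 := nullSpace_mul_eq_zero_of_adj hG hy huw
  have h3 := nullSpace_mul_eq_zero_of_adj hG hxy huw
  have hxw : x w = 0 := by simpa [hxu] using h1
  have hyu : y u = 0 := by simpa [hyw] using h2
  simp [hxw, hyu, hxu, hyw] at h3

/-- A neighbor of a support vertex has a second neighbor in the support. -/
lemma exists_ne_adj_mem_supportSet [Fintype V] {G : SimpleGraph V} {u v : V}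
    (hu : u ∈ supportSet G) (huv : G.Adj v u) : ∃ w ∈ supportSet G, w ≠ u ∧ G.Adj v w := by
  obtain ⟨x, hx, hxu⟩ := hu
  by_contra! h
  have hsum := mem_nullSpace_iff.mp hx v
  rw [Finset.sum_eq_single u, if_pos huv] at hsum
  · exact hxu hsum
  · intro w _ hwu
    split_ifs with hvw
    · by_contra hxw
      exact h w ⟨x, hx, hxw⟩ hwu hvw
    · rfl
  · simp

/-- In a forest, a nonempty set `B` of vertices disjoint from the support, each having a neighbor
in the support, has more than `|B|` support neighbors. -/
lemma ncard_lt_ncard_nbhdSet_inter_supportSet [Fintype V] {G : SimpleGraph V} (hG : G.IsAcyclic)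
    {B : Set V} (hB : B.Nonempty) (hdisj : Disjoint B (supportSet G)) (hBC : B ⊆ coreSet G) :
    B.ncard < (nbhdSet G B ∩ supportSet G).ncard := by
  set D := nbhdSet G B ∩ supportSet G
  have hBD : Disjoint B D := hdisj.mono_right Set.inter_subset_right
  have hex : ∀ b : B, ∃ d : Bool → V, Function.Injective d ∧ ∀ i, d i ∈ D ∧ G.Adj b (d i) := by
    intro b
    obtain ⟨u, hu, hub⟩ := hBC b.2
    obtain ⟨w, hw, hwu, hbw⟩ := exists_ne_adj_mem_supportSet hu hub.symm
    refine ⟨fun i ↦ if i then w else u, ?_, ?_⟩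
    · rintro (_ | _) (_ | _) h <;> simp_all
    · rintro (_ | _)
      · exact ⟨⟨⟨b, b.2, hub.symm⟩, hu⟩, hub.symm⟩
      · exact ⟨⟨⟨b, b.2, hbw⟩, hw⟩, hbw⟩
  choose d hdinj hd using hex
  have : Nonempty ↥(B ∪ D) := (hB.mono Set.subset_union_left).to_subtype
  let f : B × Bool → (G.induce (B ∪ D)).edgeSet := fun p ↦
    ⟨s(⟨p.1, Or.inl p.1.2⟩, ⟨d p.1 p.2, Or.inr (hd p.1 p.2).1⟩), (hd p.1 p.2).2⟩
  have hf : Function.Injective f := by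
    rintro ⟨b, i⟩ ⟨b', j⟩ h
    rcases Sym2.eq_iff.mp (Subtype.ext_iff.mp h) with ⟨h1, h2⟩ | ⟨h1, -⟩
    · obtain rfl : b = b' := Subtype.ext (Subtype.mk.inj h1)
      exact congrArg (Prod.mk b) (hdinj b (congrArg Subtype.val h2))
    · refine absurd (hd b' j).1 (Set.disjoint_left.mp hBD ?_)
      rw [← show (b : V) = d b' j from congrArg Subtype.val h1]
      exact b.2
  have h1 := Nat.card_le_card_of_injective f hf
  have h2 := card_edgeSet_lt_of_isAcyclic (hG.induce (B ∪ D))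
  rw [Nat.card_prod, Nat.card_eq_fintype_card (α := Bool), Fintype.card_bool,
    Nat.card_coe_set_eq] at h1
  rw [Nat.card_coe_set_eq (B ∪ D), Set.ncard_union_eq hBD] at h2
  omega

/-- In an S-tree, an independent set not contained in the support is smaller than the support. -/
lemma IsIndep.ncard_lt_ncard_supportSet [Fintype V] {S : SimpleGraph V} (hS : IsSTree S)
    {A : Set V} (hA : IsIndep S A) (hne : ¬ A ⊆ supportSet S) :
    A.ncard < (supportSet S).ncard := by
  have hcore : A \ supportSet S ⊆ coreSet S := fun v hv ↦
    (show v ∈ closedNbhd S (supportSet S) from hS.2 ▸ Set.mem_univ v).resolve_left hv.2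
  have hlt := ncard_lt_ncard_nbhdSet_inter_supportSet hS.1.isAcyclic
    (Set.sdiff_nonempty.mpr hne) Set.disjoint_sdiff_left hcore
  set D := nbhdSet S (A \ supportSet S) ∩ supportSet S
  have hdisj : Disjoint (A ∩ supportSet S) D := by
    rw [Set.disjoint_left]
    rintro v ⟨hvA, -⟩ ⟨⟨u, hu, huv⟩, -⟩
    exact hA u hu.1 v hvA huv
  have hle : (A ∩ supportSet S ∪ D).ncard ≤ (supportSet S).ncard :=
    Set.ncard_le_ncard (Set.union_subset Set.inter_subset_right Set.inter_subset_right)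
  rw [Set.ncard_union_eq hdisj] at hle
  have := Set.ncard_inter_add_ncard_sdiff_eq_ncard A (supportSet S)
  omega

/-- For an S-tree, the independence number equals `|Supp(S)|`, and the support
is the unique maximum independent set. -/
theorem stmt8 [Fintype V] (S : SimpleGraph V) (hS : IsSTree S) :
    indepNumber S = (supportSet S).ncard ∧
      ∀ A : Set V, IsIndep S A → A.ncard = (supportSet S).ncard → A = supportSet S := by
  have hle : ∀ A : Set V, IsIndep S A → A.ncard ≤ (supportSet S).ncard := fun A hA ↦ by
    by_cases h : A ⊆ supportSet S
    · exact Set.ncard_le_ncard h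
    · exact (hA.ncard_lt_ncard_supportSet hS h).le
  refine ⟨?_, fun A hA hcard ↦ ?_⟩
  · refine IsGreatest.csSup_eq ⟨⟨_, isIndep_supportSet hS.1.isAcyclic, rfl⟩, ?_⟩
    rintro n ⟨A, hA, rfl⟩
    exact hle A hA
  · by_cases h : A ⊆ supportSet S
    · exact Set.eq_of_subset_of_ncard_le h hcard.ge
    · exact absurd hcard (hA.ncard_lt_ncard_supportSet hS h).ne

end NullDecomp
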